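/- arXiv:2307.07112 — 3 statements merged into one kernel-verified Lean document; each statement's English description precedes it below -/
import Mathlib

section
/- Let x : (0,∞) → (0,∞) be a strictly decreasing function. If the function t ↦ -log x(t) is convex on (0,∞) and the function t ↦ log x(t) + t is bounded below on (0,∞), then the function r ↦ x(-log r) is concave on (0,1). -/
theorem key_aux (x0 p r r0 xr : ℝ) (hx0 : 0 < x0) (hxr : 0 < xr) (hr : 0 < r) (hr0 : 0 < r0)
    (hp0 : 0 ≤ p) (hp1 : p ≤ 1)
    (h : Real.log xr ≤ Real.log x0 + p * (Real.log r - Real.log r0)) :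
    xr ≤ x0 * (1 + p * (r / r0 - 1)) := by
  have h1 : (1 + (r / r0 - 1)) ^ p ≤ 1 + p * (r / r0 - 1) := by
    apply rpow_one_add_le_one_add_mul_self _ hp0 hp1
    have : 0 < r / r0 := div_pos hr hr0
    linarith
  have h2 : xr ≤ x0 * (r / r0) ^ p := by
    have hq : 0 < r / r0 := div_pos hr hr0
    have hq2 := Real.rpow_pos_of_pos hq p
    rw [← Real.log_le_log_iff hxr (by positivity), Real.log_mul hx0.ne' hq2.ne',
      Real.log_rpow hq, Real.log_div hr.ne' hr0.ne']
    exact h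
  rw [add_sub_cancel] at h1
  exact h2.trans (mul_le_mul_of_nonneg_left h1 hx0.le)

theorem stmt_0 (x : ℝ → ℝ)
    (hpos : ∀ t ∈ Set.Ioi (0:ℝ), 0 < x t)
    (hdec : StrictAntiOn x (Set.Ioi (0:ℝ)))
    (hconv : ConvexOn ℝ (Set.Ioi (0:ℝ)) (fun t => -Real.log (x t)))
    (hbdd : ∃ m : ℝ, ∀ t ∈ Set.Ioi (0:ℝ), m ≤ Real.log (x t) + t) :
    ConcaveOn ℝ (Set.Ioo (0:ℝ) 1) (fun r => x (-Real.log r)) := by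
  obtain ⟨m, hm⟩ := hbdd
  apply LinearOrder.concaveOn_of_lt (convex_Ioo 0 1)
  rintro r1 ⟨h10, h11⟩ r2 ⟨h20, h21⟩ h12 a b ha hb hab
  simp only [smul_eq_mul]
  obtain ⟨r0, hr0⟩ : ∃ r0, r0 = a * r1 + b * r2 := ⟨_, rfl⟩
  rw [← hr0]
  have hb' : b = 1 - a := by linarith
  have l1 : r1 < r0 := by rw [hr0, hb']; nlinarith
  have l2 : r0 < r2 := by rw [hr0, hb']; nlinarith
  have h00 : 0 < r0 := h10.trans l1
  have t1 : 0 < -Real.log r1 := by have := Real.log_neg h10 h11; linarith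
  have t2 : 0 < -Real.log r2 := by have := Real.log_neg h20 h21; linarith
  have t0 : 0 < -Real.log r0 := by have := Real.log_neg h00 (l2.trans h21); linarith
  have k1 : -Real.log r0 < -Real.log r1 := by have := Real.log_lt_log h10 l1; linarith
  have k2 : -Real.log r2 < -Real.log r0 := by have := Real.log_lt_log h00 l2; linarith
  have x0 := hpos _ t0
  have x1 := hpos _ t1
  have x2 := hpos _ t2
  have hs := fun t (ht : -Real.log r0 < t) =>
    hconv.slope_mono_adjacent (x := -Real.log r2) (y := -Real.log r0) (z := t) t2
      (t0.trans ht) k2 ht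
  obtain ⟨p, hp⟩ : ∃ p, p = (-Real.log (x (-Real.log r0)) - -Real.log (x (-Real.log r2))) /
    (-Real.log r0 - -Real.log r2) := ⟨_, rfl⟩
  rw [← hp] at hs
  have hp0 : 0 ≤ p := by
    rw [hp]
    apply div_nonneg _ (by linarith)
    have := Real.log_le_log x0 (hdec t2 t0 k2).le
    linarith
  have hs' : ∀ t, -Real.log r0 < t →
      p * (t - -Real.log r0) ≤ -Real.log (x t) - -Real.log (x (-Real.log r0)) := by
    intro t ht
    have := hs t ht
    rwa [le_div_iff₀ (by linarith)] at this
  have hp1 : p ≤ 1 := by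
    by_contra! hc
    obtain ⟨C, hC⟩ : ∃ C, C = -Real.log r0 - m + Real.log (x (-Real.log r0)) := ⟨_, rfl⟩
    have hs0 : 0 < (|C| + 1) / (p - 1) := div_pos (by positivity) (by linarith)
    have e : (p - 1) * ((|C| + 1) / (p - 1)) = |C| + 1 := by
      have : p - 1 ≠ 0 := by linarith
      field_simp
    generalize (|C| + 1) / (p - 1) = s at hs0 e
    have q1 := hs' (-Real.log r0 + s) (by linarith)
    have q2 := hm (-Real.log r0 + s) (by simp only [Set.mem_Ioi]; linarith)
    have := le_abs_self C
    have e2 : p * (-Real.log r0 + s - -Real.log r0) = (p-1)*s + s := by ring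
    linarith
  have e2 : p * (-Real.log r0 - -Real.log r2) =
      (-Real.log (x (-Real.log r0)) - -Real.log (x (-Real.log r2))) := by
    rw [hp, div_mul_cancel₀]
    linarith
  have f1 := key_aux _ p r1 r0 _ x0 x1 h10 h00 hp0 hp1 (by linarith [hs' _ k1])
  have f2 := key_aux _ p r2 r0 _ x0 x2 h20 h00 hp0 hp1 (by linarith)
  have g1 := mul_le_mul_of_nonneg_left f1 ha.le
  have g2 := mul_le_mul_of_nonneg_left f2 hb.le
  refine (add_le_add g1 g2).trans (le_of_eq ?_)
  have e3 : a * (r1 / r0) + b * (r2 / r0) = 1 := by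
    field_simp
    linarith
  linear_combination (x (-Real.log r0)) * p * e3 + x (-Real.log r0) * (1 - p) * hab
end

section
/- Let g : [0,1] → ℝ be a concave function which is strictly increasing on [0,1] and satisfies g(0) = 0. Suppose there exist r₀ ∈ (0,1) and a, b ∈ ℝ such that g(r) = a·r + b for all r ∈ [r₀,1], and suppose it is not the case that g(r) = a·r for all r ∈ [0,1]. Then the function h : [0,∞) → ℝ defined by h(t) = -log g(e^{-t}) is not convex on [0,∞). -/
theorem stmt_1 (g : ℝ → ℝ) (r₀ a b : ℝ)
    (hconc : ConcaveOn ℝ (Set.Icc (0:ℝ) 1) g)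
    (hmono : StrictMonoOn g (Set.Icc (0:ℝ) 1))
    (hg0 : g 0 = 0)
    (hr₀ : r₀ ∈ Set.Ioo (0:ℝ) 1)
    (hlin : ∀ r ∈ Set.Icc r₀ 1, g r = a * r + b)
    (hnotlin : ¬ ∀ r ∈ Set.Icc (0:ℝ) 1, g r = a * r) :
    ¬ ConvexOn ℝ (Set.Ici (0:ℝ)) (fun t => -Real.log (g (Real.exp (-t)))) := by
  obtain ⟨h0, h1⟩ := hr₀
  have g1 : g 1 = a + b := by rw [hlin 1 ⟨h1.le, le_rfl⟩]; ring
  have gr : g r₀ = a * r₀ + b := hlin r₀ ⟨le_rfl, h1.le⟩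
  have m0 : (0:ℝ) ∈ Set.Icc (0:ℝ) 1 := by simp
  have m1 : (1:ℝ) ∈ Set.Icc (0:ℝ) 1 := by simp
  have mr : r₀ ∈ Set.Icc (0:ℝ) 1 := ⟨h0.le, h1.le⟩
  have chord : ∀ r ∈ Set.Icc (0:ℝ) 1, r * (a + b) ≤ g r := by
    intro r hr
    have h := hconc.2 m0 m1 (sub_nonneg.2 hr.2) hr.1 (by ring)
    simpa [hg0, g1] using h
  have ha : 0 < a := by
    have h := hmono mr m1 h1
    rw [g1, gr] at h
    nlinarith
  have hb0 : 0 ≤ b := by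
    have h := chord r₀ mr
    rw [gr] at h
    nlinarith
  have hb : 0 < b := by
    rcases hb0.lt_or_eq with h | h
    · exact h
    exfalso
    subst h
    apply hnotlin
    intro r hr
    rcases le_or_gt r₀ r with h | h
    · rw [hlin r ⟨h, hr.2⟩]; ring
    apply le_antisymm
    · have hr1 : 0 < 1 - r := by linarith
      have h2 := hconc.2 hr m1
        (show 0 ≤ (1 - r₀) / (1 - r) from div_nonneg (by linarith) hr1.le)
        (show 0 ≤ (r₀ - r) / (1 - r) from div_nonneg (by linarith) hr1.le)
        (by field_simp; ring)
      have e : ((1 - r₀) / (1 - r)) • r + ((r₀ - r) / (1 - r)) • (1:ℝ) = r₀ := by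
        simp only [smul_eq_mul]; field_simp; ring
      rw [e, gr, g1] at h2
      simp only [smul_eq_mul] at h2
      have h3 := mul_le_mul_of_nonneg_right h2 hr1.le
      have e2 : ((1 - r₀) / (1 - r) * g r + (r₀ - r) / (1 - r) * (a + 0)) * (1 - r)
          = (1 - r₀) * g r + (r₀ - r) * a := by field_simp; ring
      rw [e2] at h3
      have h4 : (1 - r₀) * g r ≤ (1 - r₀) * (a * r) := by linarith
      exact le_of_mul_le_mul_left h4 (by linarith)
    · have := chord r hr
      linarith
  intro hc
  obtain ⟨s, hs0, hs⟩ : ∃ s : ℝ, 0 < s ∧ s ^ 2 = r₀ :=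
    ⟨√r₀, Real.sqrt_pos.2 h0, Real.sq_sqrt h0.le⟩
  have hs1 : s < 1 := by nlinarith
  have gs : g s = a * s + b := hlin s ⟨by nlinarith, hs1.le⟩
  have hl : Real.log s < 0 := Real.log_neg hs0 hs1
  have h := hc.2 (show (0:ℝ) ∈ Set.Ici (0:ℝ) by simp)
    (show -(2 * Real.log s) ∈ Set.Ici (0:ℝ) by simp only [Set.mem_Ici]; linarith)
    (show (0:ℝ) ≤ 1/2 by norm_num) (show (0:ℝ) ≤ 1/2 by norm_num) (by norm_num)
  have e1 : Real.exp (2 * Real.log s) = r₀ := by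
    rw [two_mul, Real.exp_add, Real.exp_log hs0, ← hs]; ring
  have e2 : -((1/2:ℝ) • (0:ℝ) + (1/2:ℝ) • (-(2 * Real.log s))) = Real.log s := by
    simp only [smul_eq_mul]; ring
  simp only [e2, neg_neg, neg_zero, Real.exp_zero, e1, Real.exp_log hs0, gs, gr, g1] at h
  simp only [smul_eq_mul] at h
  have p1 : 0 < a + b := by positivity
  have p2 : 0 < a * r₀ + b := by positivity
  have p3 : 0 < a * s + b := by positivity
  have h5 : Real.log ((a + b) * (a * r₀ + b)) ≤ Real.log ((a * s + b) * (a * s + b)) := by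
    rw [Real.log_mul p1.ne' p2.ne', Real.log_mul p3.ne' p3.ne']
    linarith
  rw [Real.log_le_log_iff (by positivity) (by positivity), ← hs] at h5
  have : 0 < a * b * (1 - s) ^ 2 := by
    have : 0 < 1 - s := by linarith
    positivity
  nlinarith
end

section
/- Let θ₀ ∈ (0, π], let Δ ⊂ ℂ be the open unit disc, and let L_{θ₀} := {z ∈ Δ : 0 < Arg(z) < θ₀}, where Arg(z) ∈ (-π, π] is the principal argument. Let v be a subharmonic function on Δ such that v(z) = 0 for all z ∈ L_{θ₀}. Then v(0) = 0. -/
open MeasureTheory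

/-- The average over the circle of center `z` and radius `r` of the function `u` truncated
below at level `-n`. -/
noncomputable def truncCircleAvg (u : ℂ → EReal) (z : ℂ) (r : ℝ) (n : ℕ) : ℝ :=
  (2 * Real.pi)⁻¹ *
    ∫ θ in (0:ℝ)..(2 * Real.pi),
      (max (u (z + (r : ℂ) * Complex.exp ((θ : ℂ) * Complex.I))) ((-(n : ℝ) : ℝ) : EReal)).toReal

/-- `u : U → [-∞, ∞)` is subharmonic on the open set `U` if it is upper semicontinuous,
not identically `-∞` on any connected component of `U`, and satisfies the sub-mean value
inequality on every circle whose corresponding closed disc is contained in `U` (the circle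
integral of `u` being understood as the infimum of the integrals of its truncations). -/
def SubharmonicOn (u : ℂ → EReal) (U : Set ℂ) : Prop :=
  (∀ z ∈ U, u z ≠ ⊤) ∧
  UpperSemicontinuousOn u U ∧
  (∀ z ∈ U, ∃ w ∈ connectedComponentIn U z, u w ≠ ⊥) ∧
  (∀ z : ℂ, ∀ r : ℝ, 0 < r → Metric.closedBall z r ⊆ U →
    u z ≤ ⨅ n : ℕ, ((truncCircleAvg u z r n : ℝ) : EReal))

theorem stmt_3 (θ₀ : ℝ) (hθ₀ : 0 < θ₀) (hθ₀' : θ₀ ≤ Real.pi)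
    (v : ℂ → EReal) (hv : SubharmonicOn v (Metric.ball (0:ℂ) 1))
    (hsector : ∀ z ∈ Metric.ball (0:ℂ) 1, 0 < Complex.arg z → Complex.arg z < θ₀ →
      v z = 0) :
    v 0 = 0 := by
  obtain ⟨htop, husc, -, hmean⟩ := hv
  have hpi := Real.pi_pos
  have h0 : (0:ℂ) ∈ Metric.ball (0:ℂ) 1 := by simp
  -- points on circles
  have hnorm : ∀ r : ℝ, 0 < r → ∀ θ : ℝ, ‖(r:ℂ) * Complex.exp ((θ:ℂ) * Complex.I)‖ = r := by
    intro r hr θ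
    rw [norm_mul, Complex.norm_exp_ofReal_mul_I, Complex.norm_real, Real.norm_of_nonneg hr.le, mul_one]
  have hzero : ∀ r : ℝ, 0 < r → r < 1 → ∀ θ : ℝ, 0 < θ → θ < θ₀ →
      v ((r:ℂ) * Complex.exp ((θ:ℂ) * Complex.I)) = 0 := by
    intro r hr hr1 θ h1 h2
    have harg : Complex.arg ((r:ℂ) * Complex.exp ((θ:ℂ) * Complex.I)) = θ := by
      rw [Complex.arg_real_mul _ hr, Complex.arg_exp_mul_I, toIocMod_eq_self]
      constructor <;> linarith
    apply hsector
    · rw [mem_ball_zero_iff, hnorm r hr]; exact hr1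
    · rw [harg]; exact h1
    · rw [harg]; exact h2
  have hball : ∀ b : EReal, v 0 < b → ∃ r : ℝ, 0 < r ∧ r < 1 ∧ ∀ z : ℂ, ‖z‖ = r → v z < b := by
    intro b hb
    have h := husc 0 h0 b hb
    rw [Metric.isOpen_ball.nhdsWithin_eq h0, Metric.eventually_nhds_iff] at h
    obtain ⟨δ, hδ, h⟩ := h
    refine ⟨min δ 1 / 2, by positivity, ?_, fun z hz => h ?_⟩
    · have := min_le_right δ 1; linarith
    · rw [dist_zero_right, hz]
      have := min_le_left δ 1; linarith
  by_contra hne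
  rcases lt_or_gt_of_ne hne with hlt | hgt
  · obtain ⟨r, hr, hr1, h⟩ := hball 0 hlt
    have h1 := h _ (hnorm r hr (θ₀ / 2))
    rw [hzero r hr hr1 (θ₀/2) (by linarith) (by linarith)] at h1
    exact lt_irrefl _ h1
  · obtain ⟨a, ha⟩ : ∃ a : ℝ, v 0 = a :=
      ⟨(v 0).toReal, (EReal.coe_toReal (htop 0 h0) (ne_bot_of_gt hgt)).symm⟩
    have ha0 : 0 < a := by rw [ha] at hgt; exact_mod_cast hgt
    set b : ℝ := a * (1 + θ₀ / (2 * Real.pi)) with hb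
    have hab : a < b := by
      have : 0 < a * (θ₀ / (2 * Real.pi)) := by positivity
      rw [hb]; linarith
    have hb2 : (2 * Real.pi - θ₀) * b < 2 * Real.pi * a := by
      have h1 : (2 * Real.pi - θ₀) * b = 2 * Real.pi * a - a * θ₀ ^ 2 / (2 * Real.pi) := by
        rw [hb]; field_simp; ring
      have : 0 < a * θ₀ ^ 2 / (2 * Real.pi) := by positivity
      linarith
    obtain ⟨r, hr, hr1, h⟩ := hball (b : EReal) (by rw [ha]; exact_mod_cast hab)
    have hm := (hmean 0 r hr (Metric.closedBall_subset_ball hr1)).trans (iInf_le _ 0)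
    rw [ha, EReal.coe_le_coe_iff, truncCircleAvg] at hm
    simp only [zero_add, Nat.cast_zero, neg_zero, EReal.coe_zero] at hm
    set f : ℝ → ℝ := fun θ => (max (v ((r:ℂ) * Complex.exp ((θ:ℂ) * Complex.I))) 0).toReal with hf
    have hI : 2 * Real.pi * a ≤ ∫ θ in (0:ℝ)..(2 * Real.pi), f θ := by
      rw [inv_mul_eq_div, le_div_iff₀ (by positivity)] at hm
      linarith
    have hint : IntervalIntegrable f volume 0 (2 * Real.pi) := by
      by_contra hn
      rw [intervalIntegral.integral_undef hn] at hI
      have : 0 < 2 * Real.pi * a := by positivity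
      linarith
    have hi1 : IntervalIntegrable f volume 0 θ₀ := hint.mono_set (by
      rw [Set.uIcc_of_le (by linarith), Set.uIcc_of_le (by linarith)]
      exact Set.Icc_subset_Icc le_rfl (by linarith))
    have hi2 : IntervalIntegrable f volume θ₀ (2 * Real.pi) := hint.mono_set (by
      rw [Set.uIcc_of_le (by linarith), Set.uIcc_of_le (by linarith)]
      exact Set.Icc_subset_Icc hθ₀.le le_rfl)
    have e1 : ∫ θ in (0:ℝ)..θ₀, f θ ≤ ∫ θ in (0:ℝ)..θ₀, (0:ℝ) := by
      apply intervalIntegral.integral_mono_on_of_le_Ioo hθ₀.le hi1 (by simp)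
      intro θ hθ
      simp [hf, hzero r hr hr1 θ hθ.1 hθ.2]
    have e2 : ∫ θ in θ₀..(2 * Real.pi), f θ ≤ ∫ θ in θ₀..(2 * Real.pi), b := by
      apply intervalIntegral.integral_mono_on_of_le_Ioo (by linarith) hi2 (by simp)
      intro θ hθ
      have hle : max (v ((r:ℂ) * Complex.exp ((θ:ℂ) * Complex.I))) 0 ≤ (b : EReal) :=
        max_le (h _ (hnorm r hr θ)).le (by exact_mod_cast (ha0.trans hab).le)
      have := EReal.toReal_le_toReal hle
        (ne_bot_of_le_ne_bot (by simp) (le_max_right _ (0:EReal))) (EReal.coe_ne_top b)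
      simpa [hf] using this
    rw [← intervalIntegral.integral_add_adjacent_intervals hi1 hi2] at hI
    simp only [intervalIntegral.integral_const, smul_eq_mul, mul_zero] at e1 e2
    linarith
end
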